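/- arXiv:math/0509470 — 3 statements merged into one kernel-verified Lean document; each statement's English description precedes it below -/
import Mathlib

section
/- Let S be a set of positive integers and P a set of primes such that every element of S is strictly less than every element of P. Then for every natural number n, M_{S∪P}(n) = Σ_{m=0}^{n} p_P(m) · M_S(n−m), where p_P(m) is the number of partitions of m with all parts in P. -/
/-- The product, with multiplicity, of the factorials of the elements of a multiset. -/
def factorialProd (A : Multiset ℕ) : ℕ := (A.map Nat.factorial).prod

/-- `MS S n`: the number of distinct multinomial coefficients with upper entry `n` and
lower entries in `S`. -/
noncomputable def MS (S : Set ℕ) (n : ℕ) : ℕ :=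
  Set.ncard {v : ℕ | ∃ P : Nat.Partition n, (∀ j ∈ P.parts, j ∈ S) ∧ factorialProd P.parts = v}

/-- `pS S n`: the number of partitions of `n` with all parts in `S`. -/
noncomputable def pS (S : Set ℕ) (n : ℕ) : ℕ :=
  Set.ncard {P : Nat.Partition n | ∀ j ∈ P.parts, j ∈ S}

theorem factorialProd_add (A B : Multiset ℕ) :
    factorialProd (A + B) = factorialProd A * factorialProd B := by
  simp [factorialProd]

theorem factorialProd_cons (a : ℕ) (A : Multiset ℕ) :
    factorialProd (a ::ₘ A) = a.factorial * factorialProd A := by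
  simp [factorialProd]

theorem factorialProd_pos (A : Multiset ℕ) : 0 < factorialProd A := by
  induction A using Multiset.induction with
  | empty => simp [factorialProd]
  | cons a A ih => rw [factorialProd_cons]; exact Nat.mul_pos a.factorial_pos ih

theorem prime_dvd_factorialProd {q : ℕ} (hq : q.Prime) (A : Multiset ℕ) :
    q ∣ factorialProd A ↔ ∃ a ∈ A, q ≤ a := by
  induction A using Multiset.induction with
  | empty => simp [factorialProd, hq.ne_one]
  | cons a A ih => simp [factorialProd_cons, hq.dvd_mul, hq.dvd_factorial, ih]

/-- The prime parts exceeding all other parts are determined by the product of factorials. -/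
theorem eq_of_factorialProd_mul_eq {S P : Set ℕ} (hP : ∀ q ∈ P, Nat.Prime q)
    (hSP : ∀ s ∈ S, ∀ q ∈ P, s < q) {B B' : Multiset ℕ} (hB : ∀ b ∈ B, b ∈ S)
    (hB' : ∀ b ∈ B', b ∈ S) {A A' : Multiset ℕ} (hA : ∀ a ∈ A, a ∈ P) (hA' : ∀ a ∈ A', a ∈ P)
    (h : factorialProd A * factorialProd B = factorialProd A' * factorialProd B') : A = A' := by
  have dominated {C C' D D' : Multiset ℕ} (hC : ∀ a ∈ C, a ∈ P) (hD' : ∀ b ∈ D', b ∈ S)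
      (h : factorialProd C * factorialProd D = factorialProd C' * factorialProd D')
      {q : ℕ} (hq : q ∈ C) : ∃ a ∈ C', q ≤ a := by
    have hqP := hP q (hC q hq)
    have hdvd : q ∣ factorialProd C' * factorialProd D' :=
      h ▸ ((prime_dvd_factorialProd hqP C).2 ⟨q, hq, le_rfl⟩).mul_right _
    rcases hqP.dvd_mul.1 hdvd with h' | h'
    · exact (prime_dvd_factorialProd hqP C').1 h'
    · obtain ⟨b, hb, hqb⟩ := (prime_dvd_factorialProd hqP D').1 h'
      exact absurd (hSP b (hD' b hb) q (hC q hq)) (by omega)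
  induction hk : A.card generalizing A A' with
  | zero =>
    obtain rfl := Multiset.card_eq_zero.1 hk
    by_contra hne
    obtain ⟨q, hq⟩ := Multiset.exists_mem_of_ne_zero (Ne.symm hne)
    obtain ⟨a, ha, -⟩ := dominated hA' hB h.symm hq
    simp at ha
  | succ k ih =>
    obtain ⟨q, hq, hmax⟩ := A.toFinset.exists_max_image id
      ((Multiset.toFinset_nonempty).2 (by rintro rfl; simp at hk))
    simp only [Multiset.mem_toFinset, id] at hq hmax
    obtain ⟨a, ha, hqa⟩ := dominated hA hB' h hq
    obtain ⟨b, hb, hab⟩ := dominated hA' hB h.symm ha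
    obtain rfl : q = a := le_antisymm hqa (hab.trans (hmax b hb))
    obtain ⟨C, rfl⟩ := Multiset.exists_cons_of_mem hq
    obtain ⟨C', rfl⟩ := Multiset.exists_cons_of_mem ha
    rw [ih (A := C) (A' := C') (fun a ha => hA a (Multiset.mem_cons_of_mem ha))
      (fun a ha => hA' a (Multiset.mem_cons_of_mem ha)) ?_ (by simpa using hk)]
    rw [factorialProd_cons, factorialProd_cons, mul_assoc, mul_assoc] at h
    exact Nat.eq_of_mul_eq_mul_left q.factorial_pos h

open Classical in
/-- The multisets underlying the partitions of `n` with all parts in `T`. -/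
noncomputable def partsIn (T : Set ℕ) (n : ℕ) : Finset (Multiset ℕ) :=
  (Finset.univ.filter fun p : Nat.Partition n => ∀ j ∈ p.parts, j ∈ T).image Nat.Partition.parts

theorem mem_partsIn {T : Set ℕ} (hT : ∀ t ∈ T, 0 < t) {n : ℕ} {A : Multiset ℕ} :
    A ∈ partsIn T n ↔ (∀ j ∈ A, j ∈ T) ∧ A.sum = n := by
  simp only [partsIn, Finset.mem_image, Finset.mem_filter, Finset.mem_univ, true_and]
  constructor
  · rintro ⟨p, hp, rfl⟩
    exact ⟨hp, p.parts_sum⟩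
  · rintro ⟨hA, hs⟩
    exact ⟨⟨A, fun {j} hj => hT j (hA j hj), hs⟩, hA, rfl⟩

theorem pS_eq_card (T : Set ℕ) (n : ℕ) : pS T n = (partsIn T n).card := by
  classical
  rw [partsIn, Finset.card_image_of_injective _ fun p q h => Nat.Partition.ext h, pS,
    ← Set.ncard_coe_finset]
  simp

theorem MS_eq_card (T : Set ℕ) (n : ℕ) : MS T n = ((partsIn T n).image factorialProd).card := by
  classical
  rw [MS, ← Set.ncard_coe_finset]
  congr 1
  ext v
  simp [partsIn]

/-- If `S` is a set of positive integers and `P` a set of primes, with every element of `S`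
strictly less than every element of `P`, then
`M_{S∪P}(n) = Σ_{m=0}^{n} p_P(m) · M_S(n−m)`. -/
theorem MS_union_primes (S P : Set ℕ) (hS : ∀ s ∈ S, 0 < s)
    (hP : ∀ q ∈ P, Nat.Prime q) (hSP : ∀ s ∈ S, ∀ q ∈ P, s < q) (n : ℕ) :
    MS (S ∪ P) n = ∑ m ∈ Finset.range (n + 1), pS P m * MS S (n - m) := by
  classical
  have hP0 : ∀ q ∈ P, 0 < q := fun q hq => (hP q hq).pos
  have hU0 : ∀ t ∈ S ∪ P, 0 < t := fun t ht => ht.elim (hS t) (hP0 t)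
  simp only [MS_eq_card, pS_eq_card, ← Finset.card_product]
  rw [← Finset.card_sigma]
  symm
  refine Finset.card_bij (fun x _ => factorialProd x.2.1 * x.2.2) ?_ ?_ ?_
  · rintro ⟨m, A, y⟩ hx
    simp only [Finset.mem_sigma, Finset.mem_range, Finset.mem_product, Finset.mem_image,
      mem_partsIn hP0, mem_partsIn hS] at hx
    obtain ⟨hm, ⟨hA, hAm⟩, B, ⟨hB, hBm⟩, rfl⟩ := hx
    refine Finset.mem_image.2 ⟨A + B, (mem_partsIn hU0).2 ⟨fun j hj => ?_, ?_⟩,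
      factorialProd_add A B⟩
    · exact (Multiset.mem_add.1 hj).elim (fun h => .inr (hA j h)) (fun h => .inl (hB j h))
    · rw [Multiset.sum_add]
      omega
  · rintro ⟨m, A, y⟩ hx ⟨m', A', y'⟩ hx' h
    simp only [Finset.mem_sigma, Finset.mem_range, Finset.mem_product, Finset.mem_image,
      mem_partsIn hP0, mem_partsIn hS] at hx hx' h
    obtain ⟨-, ⟨hA, rfl⟩, B, ⟨hB, -⟩, rfl⟩ := hx
    obtain ⟨-, ⟨hA', rfl⟩, B', ⟨hB', -⟩, rfl⟩ := hx'
    obtain rfl := eq_of_factorialProd_mul_eq hP hSP hB hB' hA hA' h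
    rw [Nat.eq_of_mul_eq_mul_left (factorialProd_pos A) h]
  · intro v hv
    obtain ⟨C, hC, rfl⟩ := Finset.mem_image.1 hv
    obtain ⟨hC, hCn⟩ := (mem_partsIn hU0).1 hC
    have hsplit := Multiset.filter_add_not (· ∈ P) C
    have hsum := congrArg Multiset.sum hsplit
    rw [Multiset.sum_add, hCn] at hsum
    refine ⟨⟨(C.filter (· ∈ P)).sum, C.filter (· ∈ P),
      factorialProd (C.filter (· ∉ P))⟩, ?_, ?_⟩
    · simp only [Finset.mem_sigma, Finset.mem_range, Finset.mem_product, mem_partsIn hP0]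
      refine ⟨by omega, ⟨fun j hj => (Multiset.mem_filter.1 hj).2, trivial⟩,
        Finset.mem_image_of_mem _ ((mem_partsIn hS).2 ⟨fun j hj => ?_, by omega⟩)⟩
      obtain ⟨hjC, hjP⟩ := Multiset.mem_filter.1 hj
      exact (hC j hjC).resolve_right hjP
    · rw [← factorialProd_add, hsplit]
end

section
/- For every natural number n, M_{{1}∪ℙ}(n) = Σ_{m=0}^{n} p_ℙ(m); that is, the number of distinct multinomial coefficients with upper entry n whose lower entries are all either 1 or prime equals the total number of partitions of the integers 0, 1, …, n into prime parts. -/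
/-- The set of primes. -/
def Primes : Set ℕ := {q | q.Prime}

/-- `pP n`: the number of partitions of `n` all of whose parts are prime. -/
noncomputable def pP (n : ℕ) : ℕ :=
  Set.ncard {P : Nat.Partition n | ∀ j ∈ P.parts, Nat.Prime j}

theorem dvd_factorialProd {A : Multiset ℕ} {a : ℕ} (ha : a ∈ A) (h0 : 0 < a) :
    a ∣ factorialProd A :=
  (Nat.dvd_factorial h0 le_rfl).trans (Multiset.dvd_prod (Multiset.mem_map_of_mem _ ha))

theorem factorialProd_eq_one_of_forall_eq_one {A : Multiset ℕ} (hA : ∀ a ∈ A, a = 1) :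
    factorialProd A = 1 := by
  refine Multiset.prod_eq_one fun x hx => ?_
  obtain ⟨a, ha, rfl⟩ := Multiset.mem_map.1 hx
  simp [hA a ha]

theorem exists_le_of_prime_dvd_factorialProd {A : Multiset ℕ} {p : ℕ} (hp : p.Prime)
    (h : p ∣ factorialProd A) : ∃ a ∈ A, p ≤ a := by
  obtain ⟨x, hx, hpx⟩ := hp.prime.exists_mem_multiset_dvd h
  obtain ⟨a, ha, rfl⟩ := Multiset.mem_map.1 hx
  exact ⟨a, ha, hp.dvd_factorial.1 hpx⟩

/-- The largest prime factor of a product of factorials of primes is one of those primes. -/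
theorem mem_of_isGreatest_prime_dvd {A : Multiset ℕ} (hA : ∀ a ∈ A, a.Prime) {p : ℕ}
    (hp : IsGreatest {q : ℕ | q.Prime ∧ q ∣ factorialProd A} p) : p ∈ A := by
  obtain ⟨a, ha, hpa⟩ := exists_le_of_prime_dvd_factorialProd hp.1.1 hp.1.2
  have hap : a ≤ p := hp.2 ⟨hA a ha, dvd_factorialProd ha (hA a ha).pos⟩
  exact le_antisymm hpa hap ▸ ha

/-- A multiset of primes is determined by the product of the factorials of its elements. -/
theorem factorialProd_injOn_primes :
    Set.InjOn factorialProd {A : Multiset ℕ | ∀ a ∈ A, a.Prime} := by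
  intro A
  induction A using Multiset.strongInductionOn with
  | ih A ih =>
    intro hA B hB h
    by_cases h1 : factorialProd A = 1
    · have key : ∀ C : Multiset ℕ, (∀ c ∈ C, c.Prime) → factorialProd C = 1 → C = 0 := by
        intro C hC hC1
        refine Multiset.eq_zero_of_forall_notMem fun c hc => (hC c hc).one_lt.ne' ?_
        exact Nat.dvd_one.1 (hC1 ▸ dvd_factorialProd hc (hC c hc).pos)
      rw [key A hA h1, key B hB (h ▸ h1)]
    · have h0 : factorialProd A ≠ 0 := by
        simp [factorialProd, Nat.factorial_ne_zero]
      obtain ⟨p, hp⟩ : ∃ p, IsGreatest {q : ℕ | q.Prime ∧ q ∣ factorialProd A} p := by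
        refine ⟨_, Nat.sSup_mem ?_ ?_, fun q hq => le_csSup ?_ hq⟩
        · exact Nat.exists_prime_and_dvd h1
        all_goals exact ⟨factorialProd A, fun q hq => Nat.le_of_dvd (Nat.pos_of_ne_zero h0) hq.2⟩
      obtain ⟨A', rfl⟩ := Multiset.exists_cons_of_mem (mem_of_isGreatest_prime_dvd hA hp)
      rw [h] at hp
      obtain ⟨B', rfl⟩ := Multiset.exists_cons_of_mem (mem_of_isGreatest_prime_dvd hB hp)
      rw [factorialProd_cons, factorialProd_cons] at h
      rw [ih A' (Multiset.lt_cons_self _ _) (fun a ha => hA a (Multiset.mem_cons_of_mem ha))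
        (fun b hb => hB b (Multiset.mem_cons_of_mem hb))
        (Nat.eq_of_mul_eq_mul_left (Nat.factorial_pos p) h)]

/-- The values of `factorialProd` on partitions into ones and primes are its values on
multisets of primes with sum at most `n`. -/
theorem exists_partition_one_union_primes_iff (n v : ℕ) :
    (∃ P : Nat.Partition n, (∀ j ∈ P.parts, j ∈ ({1} ∪ Primes : Set ℕ)) ∧
      factorialProd P.parts = v) ↔
    ∃ A : Multiset ℕ, (∀ a ∈ A, a.Prime) ∧ A.sum ≤ n ∧ factorialProd A = v := by
  constructor
  · rintro ⟨P, hP, rfl⟩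
    have hsplit := Multiset.filter_add_not Nat.Prime P.parts
    refine ⟨P.parts.filter Nat.Prime, fun a ha => (Multiset.mem_filter.1 ha).2, ?_, ?_⟩
    · have hsum := congrArg Multiset.sum hsplit
      rw [Multiset.sum_add, P.parts_sum] at hsum
      omega
    · conv_rhs => rw [← hsplit, factorialProd_add]
      rw [factorialProd_eq_one_of_forall_eq_one (A := P.parts.filter fun a => ¬ a.Prime), mul_one]
      intro a ha
      obtain ⟨ha, hna⟩ := Multiset.mem_filter.1 ha
      exact (hP a ha).resolve_right hna
  · rintro ⟨A, hA, hsum, rfl⟩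
    have hmem : ∀ j ∈ A + Multiset.replicate (n - A.sum) 1, j = 1 ∨ j.Prime := by
      intro j hj
      rcases Multiset.mem_add.1 hj with hj | hj
      · exact .inr (hA j hj)
      · exact .inl (Multiset.eq_of_mem_replicate hj)
    refine ⟨⟨A + Multiset.replicate (n - A.sum) 1, fun {j} hj => ?_, ?_⟩, hmem, ?_⟩
    · rcases hmem j hj with rfl | h
      exacts [one_pos, h.pos]
    · simp [hsum]
    · rw [factorialProd_add, factorialProd_eq_one_of_forall_eq_one
        (fun a => Multiset.eq_of_mem_replicate), mul_one]

/-- The number of distinct multinomial coefficients with upper entry `n` whose lower entries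
are all either `1` or prime equals `Σ_{m=0}^{n} p_ℙ(m)`. -/
theorem MS_one_union_primes (n : ℕ) :
    MS ({1} ∪ Primes) n = ∑ m ∈ Finset.range (n + 1), pP m := by
  classical
  let T := (Finset.range (n + 1)).sigma fun m =>
    Finset.univ.filter fun P : Nat.Partition m => ∀ j ∈ P.parts, Nat.Prime j
  have hT : T.card = ∑ m ∈ Finset.range (n + 1), pP m := by
    rw [Finset.card_sigma]
    refine Finset.sum_congr rfl fun m _ => ?_
    rw [pP, ← Set.ncard_coe_finset]
    simp
  have himage : {v : ℕ | ∃ P : Nat.Partition n,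
      (∀ j ∈ P.parts, j ∈ ({1} ∪ Primes : Set ℕ)) ∧ factorialProd P.parts = v} =
      T.image fun x => factorialProd x.2.parts := by
    ext v
    rw [Set.mem_ofPred_eq, exists_partition_one_union_primes_iff]
    simp only [Finset.coe_image, Set.mem_image, Finset.mem_coe, T, Finset.mem_sigma,
      Finset.mem_range, Finset.mem_filter, Finset.mem_univ, true_and]
    constructor
    · rintro ⟨A, hA, hsum, rfl⟩
      exact ⟨⟨A.sum, A, fun {j} hj => (hA j hj).pos, rfl⟩, ⟨Nat.lt_succ_of_le hsum, hA⟩, rfl⟩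
    · rintro ⟨⟨m, P⟩, ⟨hm, hP⟩, rfl⟩
      exact ⟨P.parts, hP, P.parts_sum.trans_le (Nat.le_of_lt_succ hm), rfl⟩
  rw [MS, himage, Set.ncard_coe_finset, Finset.card_image_of_injOn, hT]
  rintro ⟨m, P⟩ hP ⟨k, Q⟩ hQ h
  have hparts : P.parts = Q.parts :=
    factorialProd_injOn_primes (Finset.mem_filter.1 (Finset.mem_sigma.1 hP).2).2
      (Finset.mem_filter.1 (Finset.mem_sigma.1 hQ).2).2 h
  obtain rfl : m = k := by rw [← P.parts_sum, ← Q.parts_sum, hparts]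
  rw [Nat.Partition.ext hparts]
end

section
/- Let S be a finite nonempty set of positive integers. Then there exists a polynomial f with integer coefficients such that, as formal power series over ℤ, (∏_{j∈S} (1 − q^j)) · Σ_{n≥0} M_S(n) q^n = f(q). -/
open PowerSeries in
/-- The generating function counting the elements of `A ⊆ ℕ^ι` by their `w`-weighted degree. -/
noncomputable def hilbertSeries {ι : Type*} [Fintype ι] (w : ι → ℕ) (A : Set (ι → ℕ)) : ℤ⟦X⟧ :=
  mk fun n => ({a ∈ A | ∑ i, a i * w i = n}.ncard : ℤ)

section HilbertSeries

open PowerSeries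

variable {ι : Type*} [Fintype ι] {w : ι → ℕ}

theorem finite_weighted_degree_eq (hw : ∀ i, 0 < w i) (A : Set (ι → ℕ)) (n : ℕ) :
    {a ∈ A | ∑ i, a i * w i = n}.Finite := by
  refine (Set.Finite.pi' fun _ : ι => Set.finite_Iic n).subset ?_
  rintro a ⟨-, ha⟩ i
  calc a i ≤ a i * w i := Nat.le_mul_of_pos_right _ (hw i)
    _ ≤ ∑ i, a i * w i :=
      Finset.single_le_sum (f := fun i => a i * w i) (fun _ _ => Nat.zero_le _) (Finset.mem_univ i)
    _ = n := ha

theorem hilbertSeries_empty : hilbertSeries w ∅ = 0 := by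
  ext n
  simp [hilbertSeries]

theorem hilbertSeries_union_add_inter (hw : ∀ i, 0 < w i) (A B : Set (ι → ℕ)) :
    hilbertSeries w (A ∪ B) + hilbertSeries w (A ∩ B) = hilbertSeries w A + hilbertSeries w B := by
  ext n
  have h := Set.ncard_union_add_ncard_inter {a ∈ A | ∑ i, a i * w i = n}
    {a ∈ B | ∑ i, a i * w i = n} (finite_weighted_degree_eq hw A n)
    (finite_weighted_degree_eq hw B n)
  have h1 : {a ∈ A | ∑ i, a i * w i = n} ∪ {a ∈ B | ∑ i, a i * w i = n} =
      {a ∈ A ∪ B | ∑ i, a i * w i = n} := by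
    ext a; simp only [Set.mem_union, Set.mem_ofPred_eq]; tauto
  have h2 : {a ∈ A | ∑ i, a i * w i = n} ∩ {a ∈ B | ∑ i, a i * w i = n} =
      {a ∈ A ∩ B | ∑ i, a i * w i = n} := by
    ext a; simp only [Set.mem_inter_iff, Set.mem_ofPred_eq]; tauto
  rw [h1, h2] at h
  simp only [hilbertSeries, map_add, coeff_mk]
  exact_mod_cast h

theorem hilbertSeries_compl (hw : ∀ i, 0 < w i) (A : Set (ι → ℕ)) :
    hilbertSeries w Aᶜ = hilbertSeries w Set.univ - hilbertSeries w A := by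
  have h := hilbertSeries_union_add_inter hw A Aᶜ
  rw [Set.union_compl_self, Set.inter_compl_self, hilbertSeries_empty] at h
  linear_combination -h

theorem hilbertSeries_Ici (a : ι → ℕ) :
    hilbertSeries w (Set.Ici a) = X ^ (∑ i, a i * w i) * hilbertSeries w Set.univ := by
  ext n
  rw [coeff_X_pow_mul']
  simp only [hilbertSeries, coeff_mk]
  split_ifs with h
  · norm_cast
    rw [← Set.ncard_image_of_injective {b ∈ Set.univ | ∑ i, b i * w i = n - ∑ i, a i * w i}
      (add_right_injective a)]
    congr 1
    ext b
    simp only [Set.mem_ofPred_eq, Set.mem_image, Set.mem_univ, true_and, Set.mem_Ici]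
    constructor
    · rintro ⟨hab, hb⟩
      obtain ⟨c, rfl⟩ := exists_add_of_le hab
      refine ⟨c, ?_, rfl⟩
      simp only [Pi.add_apply, add_mul, Finset.sum_add_distrib] at hb
      omega
    · rintro ⟨c, hc, rfl⟩
      refine ⟨le_self_add, ?_⟩
      simp only [Pi.add_apply, add_mul, Finset.sum_add_distrib]
      omega
  · norm_cast
    convert Set.ncard_empty (ι → ℕ)
    rw [Set.eq_empty_iff_forall_notMem]
    rintro b ⟨hab, hb⟩
    exact h (hb ▸ Finset.sum_le_sum fun i _ => Nat.mul_le_mul_right _ (hab i))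

theorem one_sub_X_pow_mul_mk_dvd {d : ℕ} (hd : 0 < d) :
    (1 - (X : ℤ⟦X⟧) ^ d) * mk (fun n => if d ∣ n then 1 else 0) = 1 := by
  ext n
  rw [sub_mul, one_mul, map_sub, coeff_X_pow_mul', coeff_one]
  simp only [coeff_mk]
  by_cases h : d ≤ n
  · have hn : n ≠ 0 := by omega
    simp [h, hn, (Nat.dvd_sub_iff_left h dvd_rfl)]
  · rcases Nat.eq_zero_or_pos n with rfl | hn
    · simp [hd.ne']
    · simp [h, hn.ne', Nat.not_dvd_of_pos_of_lt hn (not_le.mp h)]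

theorem hilbertSeries_univ (hw : ∀ i, 0 < w i) :
    hilbertSeries w Set.univ = ∏ i, mk (fun n => if w i ∣ n then (1 : ℤ) else 0) := by
  classical
  ext n
  rw [coeff_prod]
  simp only [hilbertSeries, coeff_mk, Fintype.prod_ite_zero, Finset.prod_const_one]
  rw [Finset.sum_boole, ← Set.ncard_coe_finset]
  congr 1
  refine Set.ncard_congr (fun a _ => Finsupp.equivFunOnFinite.symm fun i => a i * w i) ?_ ?_ ?_
  · rintro a ⟨-, ha⟩
    simpa [Finset.mem_finsuppAntidiag] using ha
  · intro a b _ _ hab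
    ext i
    exact Nat.eq_of_mul_eq_mul_right (hw i) (DFunLike.congr_fun hab i)
  · intro l hl
    simp only [Finset.coe_filter, Finset.mem_finsuppAntidiag, Set.mem_ofPred_eq] at hl
    refine ⟨fun i => l i / w i, ⟨trivial, ?_⟩, ?_⟩
    · simpa only [Nat.div_mul_cancel (hl.2 _)] using hl.1.1
    · ext i
      exact Nat.div_mul_cancel (hl.2 i)

theorem prod_one_sub_X_pow_mul_hilbertSeries_univ (hw : ∀ i, 0 < w i) :
    (∏ i, (1 - (X : ℤ⟦X⟧) ^ w i)) * hilbertSeries w Set.univ = 1 := by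
  rw [hilbertSeries_univ hw, ← Finset.prod_mul_distrib]
  exact Finset.prod_eq_one fun i _ => one_sub_X_pow_mul_mk_dvd (hw i)

theorem exists_polynomial_hilbertSeries_upperClosure (hw : ∀ i, 0 < w i)
    (F : Finset (ι → ℕ)) :
    ∃ f : Polynomial ℤ, (∏ i, (1 - (X : ℤ⟦X⟧) ^ w i)) *
      hilbertSeries w (upperClosure (F : Set (ι → ℕ))) = f := by
  classical
  induction hk : F.card using Nat.strong_induction_on generalizing F with
  | _ k ih =>
  subst hk
  rcases F.eq_empty_or_nonempty with rfl | ⟨a, ha⟩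
  · exact ⟨0, by simp [hilbertSeries_empty]⟩
  have hlt : (F.erase a).card < F.card := Finset.card_erase_lt_of_mem ha
  obtain ⟨f, hf⟩ := ih _ hlt (F.erase a) rfl
  obtain ⟨g, hg⟩ := ih _ (Finset.card_image_le.trans_lt hlt) ((F.erase a).image (· ⊔ a)) rfl
  have hunion : (upperClosure (F : Set (ι → ℕ)) : Set (ι → ℕ)) =
      (upperClosure (F.erase a : Set (ι → ℕ)) : Set (ι → ℕ)) ∪ Set.Ici a := by
    conv_lhs => rw [← Finset.insert_erase ha]
    ext b
    rw [Finset.coe_insert]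
    simp only [SetLike.mem_coe, mem_upperClosure, Set.mem_union, Set.mem_Ici, Set.exists_mem_insert]
    exact or_comm
  have hinter : (upperClosure (((F.erase a).image (· ⊔ a) : Finset (ι → ℕ)) : Set (ι → ℕ)) :
      Set (ι → ℕ)) = ↑(upperClosure (F.erase a : Set (ι → ℕ))) ∩ Set.Ici a := by
    ext b
    simp [mem_upperClosure, ← exists_and_right, and_assoc]
  have h := hilbertSeries_union_add_inter hw
    (upperClosure (F.erase a : Set (ι → ℕ)) : Set (ι → ℕ)) (Set.Ici a)
  rw [← hunion, ← hinter, hilbertSeries_Ici] at h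
  refine ⟨f + Polynomial.X ^ (∑ i, a i * w i) - g, ?_⟩
  rw [Polynomial.coe_sub, Polynomial.coe_add, Polynomial.coe_pow, Polynomial.coe_X, ← hf, ← hg]
  linear_combination (∏ i, (1 - (X : ℤ⟦X⟧) ^ w i)) * h +
    X ^ (∑ i, a i * w i) * prod_one_sub_X_pow_mul_hilbertSeries_univ hw

theorem IsUpperSet.exists_finset_upperClosure_eq {U : Set (ι → ℕ)} (hU : IsUpperSet U) :
    ∃ F : Finset (ι → ℕ), (upperClosure (F : Set (ι → ℕ)) : Set (ι → ℕ)) = U := by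
  have hfin : {a | Minimal (· ∈ U) a}.Finite :=
    WellQuasiOrderedLE.finite_of_isAntichain (setOfPred_minimal_antichain _)
  refine ⟨hfin.toFinset, ?_⟩
  ext b
  simp only [Set.Finite.coe_toFinset, SetLike.mem_coe, mem_upperClosure, Set.mem_ofPred_eq]
  constructor
  · rintro ⟨a, ha, hab⟩
    exact hU hab ha.prop
  · intro hb
    obtain ⟨a, hab, ha⟩ := exists_minimal_le_of_wellFoundedLT (· ∈ U) b hb
    exact ⟨a, ha, hab⟩

theorem IsUpperSet.exists_polynomial_hilbertSeries_compl (hw : ∀ i, 0 < w i)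
    {U : Set (ι → ℕ)} (hU : IsUpperSet U) :
    ∃ f : Polynomial ℤ, (∏ i, (1 - (X : ℤ⟦X⟧) ^ w i)) * hilbertSeries w Uᶜ = f := by
  obtain ⟨F, rfl⟩ := hU.exists_finset_upperClosure_eq
  obtain ⟨f, hf⟩ := exists_polynomial_hilbertSeries_upperClosure hw F
  refine ⟨1 - f, ?_⟩
  rw [hilbertSeries_compl hw, mul_sub, prod_one_sub_X_pow_mul_hilbertSeries_univ hw, hf,
    Polynomial.coe_sub, Polynomial.coe_one]

/-- The number of values in each degree of a monoid homomorphism out of `ℕ^ι` has a rational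
generating function. -/
theorem exists_polynomial_mk_ncard_image [LinearOrder ι] (hw : ∀ i, 0 < w i) {M : Type*}
    [CommMonoid M] (x : ι → M) :
    ∃ f : Polynomial ℤ, (∏ i, (1 - (X : ℤ⟦X⟧) ^ w i)) *
      mk (fun n => (((fun a : ι → ℕ => ∏ i, x i ^ a i) ''
        {a | ∑ i, a i * w i = n}).ncard : ℤ)) = f := by
  let U : Set (ι → ℕ) := {a | ∃ b : ι → ℕ, ∑ i, b i * w i = ∑ i, a i * w i ∧
    ∏ i, x i ^ b i = ∏ i, x i ^ a i ∧ toLex b < toLex a}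
  have hU : IsUpperSet U := by
    rintro a a' haa' ⟨b, hb, hx, hlt⟩
    obtain ⟨c, rfl⟩ := exists_add_of_le haa'
    refine ⟨b + c, ?_, ?_, ?_⟩
    · simp only [Pi.add_apply, add_mul, Finset.sum_add_distrib, hb]
    · simp only [Pi.add_apply, pow_add, Finset.prod_mul_distrib, hx]
    · rw [toLex_add, toLex_add]
      exact add_lt_add_left hlt _
  obtain ⟨f, hf⟩ := hU.exists_polynomial_hilbertSeries_compl hw
  refine ⟨f, ?_⟩
  rw [← hf]
  congr 1
  ext n
  simp only [hilbertSeries, coeff_mk]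
  have hinj : Set.InjOn (fun a : ι → ℕ => ∏ i, x i ^ a i)
      {a ∈ Uᶜ | ∑ i, a i * w i = n} := by
    rintro a ⟨ha, han⟩ b ⟨hb, hbn⟩ hab
    rcases lt_trichotomy (toLex a) (toLex b) with h | h | h
    · exact absurd ⟨a, han.trans hbn.symm, hab, h⟩ hb
    · exact toLex.injective h
    · exact absurd ⟨b, hbn.trans han.symm, hab.symm, h⟩ ha
  rw [← hinj.ncard_image]
  congr 2
  apply Set.Subset.antisymm
  · rintro _ ⟨a, han, rfl⟩
    obtain ⟨b, ⟨hbn, hba⟩, hmin⟩ := WellFounded.has_min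
      (InvImage.wf (toLex : (ι → ℕ) → Lex (ι → ℕ)) wellFounded_lt)
      {b | ∑ i, b i * w i = n ∧ ∏ i, x i ^ b i = ∏ i, x i ^ a i} ⟨a, han, rfl⟩
    refine ⟨b, ⟨?_, hbn⟩, hba⟩
    rintro ⟨c, hc, hcx, hlt⟩
    exact hmin c ⟨hc.trans hbn, hcx.trans hba⟩ hlt
  · exact Set.image_mono fun a ha => ha.2

end HilbertSeries

theorem Multiset.eq_sum_count_nsmul_singleton {α : Type*} [DecidableEq α] {S : Finset α}
    {A : Multiset α} (hA : ∀ j ∈ A, j ∈ S) : A = ∑ j : S, A.count ↑j • {(j : α)} := by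
  rw [Finset.sum_coe_sort S fun j => A.count j • ({j} : Multiset α)]
  ext k
  simp only [Multiset.count_sum', Multiset.count_nsmul, Multiset.count_singleton, mul_ite, mul_one,
    mul_zero, Finset.sum_ite_eq]
  split_ifs with h
  · rfl
  · exact Multiset.count_eq_zero.mpr fun hk => h (hA k hk)

theorem factorialProd_sum_nsmul_singleton {S : Finset ℕ} (a : S → ℕ) :
    factorialProd (∑ j : S, a j • {(j : ℕ)}) = ∏ j : S, (Nat.factorial j) ^ a j := by
  rw [factorialProd, ← Multiset.coe_mapAddMonoidHom, map_sum, Multiset.prod_sum]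
  simp [Multiset.map_nsmul, Multiset.prod_nsmul]

theorem sum_sum_nsmul_singleton {S : Finset ℕ} (a : S → ℕ) :
    (∑ j : S, a j • {(j : ℕ)} : Multiset ℕ).sum = ∑ j : S, a j * (j : ℕ) := by
  rw [← Multiset.coe_sumAddMonoidHom, map_sum]
  simp [Multiset.sum_nsmul]

theorem MS_eq_ncard_image {S : Finset ℕ} (hpos : ∀ j ∈ S, 0 < j) (n : ℕ) :
    MS S n = ((fun a : S → ℕ => ∏ j : S, (Nat.factorial j) ^ a j) ''
      {a | ∑ j : S, a j * (j : ℕ) = n}).ncard := by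
  rw [MS]
  congr 1
  ext v
  constructor
  · rintro ⟨P, hP, rfl⟩
    have h := Multiset.eq_sum_count_nsmul_singleton hP
    refine ⟨fun j => P.parts.count ↑j, ?_, ?_⟩
    · rw [Set.mem_ofPred_eq, ← sum_sum_nsmul_singleton, ← h, P.parts_sum]
    · dsimp only
      rw [← factorialProd_sum_nsmul_singleton, ← h]
  · rintro ⟨a, ha, rfl⟩
    have hmem : ∀ j ∈ (∑ j : S, a j • {(j : ℕ)} : Multiset ℕ), j ∈ S := by
      intro j hj
      obtain ⟨i, -, hi⟩ := Multiset.mem_sum.mp hj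
      rw [Multiset.mem_singleton.mp (Multiset.mem_of_mem_nsmul hi)]
      exact i.2
    exact ⟨⟨_, fun hj => hpos _ (hmem _ hj), (sum_sum_nsmul_singleton a).trans ha⟩, hmem,
      factorialProd_sum_nsmul_singleton a⟩

/-- For a finite nonempty set `S` of positive integers there is an integer polynomial `f` with
`(∏_{j∈S} (1 − q^j)) · Σ_{n≥0} M_S(n) qⁿ = f(q)` as formal power series over `ℤ`. -/
theorem MS_generating_function_polynomial (S : Finset ℕ) (hne : S.Nonempty)
    (hpos : ∀ j ∈ S, 0 < j) :
    ∃ f : Polynomial ℤ,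
      (∏ j ∈ S, (1 - (PowerSeries.X : PowerSeries ℤ) ^ j)) *
        PowerSeries.mk (fun n => (MS (↑S : Set ℕ) n : ℤ)) = (f : PowerSeries ℤ) := by
  simp only [MS_eq_ncard_image hpos]
  rw [← Finset.prod_coe_sort S fun j => 1 - (PowerSeries.X : PowerSeries ℤ) ^ j]
  exact exists_polynomial_mk_ncard_image (fun j : S => hpos j j.2)
    fun j : S => Nat.factorial j
end
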